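/- arXiv:1707.00401 — 3 statements merged into one kernel-verified Lean document; each statement's English description precedes it below -/
import Mathlib

section
/- Spectrum of a connected digraph-function: Let n ≥ 1, let f : Fin n → Fin n be a function whose digraph-function D_f is connected, and let k be the number of periodic points of f (the length of the unique directed cycle of D_f). Then for every λ ∈ ℝ: det(λ·I − A_f) = λ^{n−k} · (λ^k − 1). -/
open Matrix

/-- The underlying simple graph of the digraph of a function `f`. -/
def funGraph {n : ℕ} (f : Fin n → Fin n) : SimpleGraph (Fin n) where
  Adj x y := x ≠ y ∧ (f x = y ∨ f y = x)
  symm := ⟨fun _ _ h => ⟨h.1.symm, h.2.symm⟩⟩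
  loopless := ⟨fun _ h => h.1 rfl⟩


theorem pow_fun_matrix {V : Type*} [Fintype V] [DecidableEq V] (g : V → V)
    (B : Matrix V V ℝ) (hB : ∀ i j, B i j = if j = g i then 1 else 0) (m : ℕ) :
    ∀ i j, (B ^ m) i j = if j = g^[m] i then 1 else 0 := by
  induction m with
  | zero => intro i j; simp [Matrix.one_apply, eq_comm]
  | succ m ih =>
    intro i j
    rw [pow_succ', Matrix.mul_apply]
    simp only [hB, ih, Function.iterate_succ_apply]
    rw [Finset.sum_eq_single (g i)]
    · by_cases hj : j = g^[m] (g i) <;> simp [hj]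
    · intro b _ hb; simp [hb]
    · intro h; exact absurd (Finset.mem_univ _) h

theorem det_cycle {V : Type*} [Fintype V] [DecidableEq V] (g : V → V)
    (B : Matrix V V ℝ) (hB : ∀ i j, B i j = if j = g i then 1 else 0)
    (c : V) (hc : c ∈ Function.periodicPts g) (hs : ∀ y, ∃ j, g^[j] c = y) (lam : ℝ) :
    (lam • (1 : Matrix V V ℝ) - B).det = lam ^ Fintype.card V - 1 := by
  have hpos : 0 < Function.minimalPeriod g c := Function.minimalPeriod_pos_of_mem_periodicPts hc
  have hinj := Function.iterate_injOn_Iio_minimalPeriod (f := g) (x := c)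
  have hcard : Fintype.card V = Function.minimalPeriod g c := by
    have hb : Function.Bijective
        (fun i : Fin (Function.minimalPeriod g c) => g^[(i : ℕ)] c) := by
      constructor
      · intro a b h
        exact Fin.ext (hinj a.2 b.2 h)
      · intro y
        obtain ⟨j, rfl⟩ := hs y
        exact ⟨⟨j % Function.minimalPeriod g c, Nat.mod_lt _ hpos⟩,
          Function.iterate_mod_minimalPeriod_eq⟩
    simpa using (Fintype.card_of_bijective hb).symm
  have hdet : (lam • (1 : Matrix V V ℝ) - B).det = B.charpoly.eval lam := by
    rw [Matrix.eval_charpoly, Matrix.smul_one_eq_diagonal]; rfl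
  have : Nonempty V := ⟨c⟩
  rw [hdet, hcard]
  set k := Function.minimalPeriod g c with hkdef
  have hdeg : B.charpoly.natDegree = k := by rw [Matrix.charpoly_natDegree_eq_dim, hcard]
  have hlead : B.charpoly.coeff k = 1 := by
    rw [← hdeg]; exact B.charpoly_monic
  have hper : g^[k] c = c := Function.iterate_minimalPeriod
  have hCH := Matrix.aeval_self_charpoly B
  rw [Polynomial.aeval_eq_sum_range, hdeg, Finset.sum_range_succ, hlead] at hCH
  have hent : ∀ j, j < k → B.charpoly.coeff j + (if j = 0 then 1 else 0) = 0 := by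
    intro j hj
    have h := congrFun (congrFun hCH c) (g^[j] c)
    simp only [Matrix.add_apply, Matrix.sum_apply, Matrix.smul_apply, pow_fun_matrix g B hB,
      hper, Matrix.zero_apply, one_smul, smul_eq_mul] at h
    rw [Finset.sum_eq_single j] at h
    · have e : (g^[j] c = c) ↔ j = 0 := by
        constructor
        · intro h'
          exact hinj hj hpos h'
        · rintro rfl; rfl
      simpa [e] using h
    · intro b hb hne
      rw [if_neg, mul_zero]
      intro h'
      exact hne (hinj hj (Finset.mem_range.1 hb) h').symm
    · intro h'; exact absurd (Finset.mem_range.2 hj) h'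
  rw [Polynomial.eval_eq_sum_range, hdeg, Finset.sum_range_succ, hlead,
    Finset.sum_eq_single 0]
  · have := hent 0 hpos
    simp at this ⊢
    linarith
  · intro b hb hne
    have := hent b (Finset.mem_range.1 hb)
    simp [hne] at this
    simp [this]
  · intro h'; exact absurd (Finset.mem_range.2 hpos) h'

theorem det_depth {V : Type*} [Fintype V] [DecidableEq V] (d : V → ℕ)
    (M : Matrix V V ℝ) (lam : ℝ) (hd : ∀ i, M i i = lam)
    (hM : ∀ i j, i ≠ j → d i ≤ d j → M i j = 0) :
    M.det = lam ^ Fintype.card V := by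
  have hbt : M.BlockTriangular (fun i => OrderDual.toDual (d i)) := by
    intro i j h
    have h' : d i < d j := h
    exact hM i j (by rintro rfl; exact lt_irrefl _ h') h'.le
  have hblock : ∀ a, (M.toSquareBlock (fun i => OrderDual.toDual (d i)) a).det
      = lam ^ (Finset.univ.filter (fun i => OrderDual.toDual (d i) = a)).card := by
    intro a
    have : M.toSquareBlock (fun i => OrderDual.toDual (d i)) a
        = Matrix.diagonal (fun _ => lam) := by
      ext ⟨i, hi⟩ ⟨j, hj⟩
      by_cases hij : i = j
      · subst hij; simp [Matrix.toSquareBlock_def, hd]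
      · have e : d i = d j := hi.trans hj.symm
        rw [Matrix.diagonal_apply_ne _ (by simpa using hij)]
        exact hM i j hij e.le
    rw [this, Matrix.det_diagonal, Finset.prod_const, Finset.card_univ, Fintype.card_subtype]
  rw [hbt.det, Finset.prod_congr rfl (fun a _ => hblock a), Finset.prod_pow_eq_pow_sum,
    ← Finset.card_univ,
    Finset.card_eq_sum_card_image (fun i => OrderDual.toDual (d i)) Finset.univ]

/-- Spectrum of a connected digraph-function: `A(λ, D_f) = λ^(n-k) (λ^k - 1)`,
where `k` is the number of periodic points of `f`. -/
theorem spectrum_digraph_function (n : ℕ) (hn : 1 ≤ n) (f : Fin n → Fin n)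
    (hconn : (funGraph f).Connected)
    (k : ℕ) (hk : k = Nat.card {x : Fin n // ∃ m, 1 ≤ m ∧ f^[m] x = x})
    (A : Matrix (Fin n) (Fin n) ℝ)
    (hA : ∀ i j, A i j = if j = f i then 1 else 0)
    (lam : ℝ) :
    (lam • (1 : Matrix (Fin n) (Fin n) ℝ) - A).det
      = lam ^ (n - k) * (lam ^ k - 1) := by
  classical
  have hmeet : ∀ x y, ∃ a b, f^[a] x = f^[b] y := by
    intro x y
    obtain ⟨w⟩ := hconn.preconnected x y
    induction w with
    | nil => exact ⟨0, 0, rfl⟩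
    | @cons u v w h _ ih =>
      obtain ⟨a, b, hab⟩ := ih
      rcases h.2 with h | h
      · exact ⟨a + 1, b, by rw [Function.iterate_succ_apply, h, hab]⟩
      · refine ⟨a, b + 1, ?_⟩
        rw [← h, ← Function.iterate_succ_apply, Function.iterate_succ_apply', hab,
          Function.iterate_succ_apply']
  have hev : ∀ x, ∃ m, f^[m] x ∈ Function.periodicPts f := by
    intro x
    obtain ⟨a, b, hne, hab⟩ := Finite.exists_ne_map_eq_of_infinite (fun m : ℕ => f^[m] x)
    have key : ∀ a b : ℕ, a < b → f^[a] x = f^[b] x →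
        ∃ m, f^[m] x ∈ Function.periodicPts f := by
      intro a b h e
      refine ⟨a, b - a, by omega, ?_⟩
      change f^[b - a] (f^[a] x) = f^[a] x
      rw [← Function.iterate_add_apply, Nat.sub_add_cancel h.le, e]
    rcases lt_or_gt_of_ne hne with h | h
    · exact key a b h hab
    · exact key b a h hab.symm
  have hmaps : ∀ x, x ∈ Function.periodicPts f → f x ∈ Function.periodicPts f := by
    rintro x ⟨m, hm, hx⟩
    exact ⟨m, hm, hx.map (Function.Commute.refl f)⟩
  let p : Fin n → Prop := fun x => x ∈ Function.periodicPts f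
  have hkp : k = Fintype.card {x // p x} := by
    rw [hk, Nat.card_eq_fintype_card]; rfl
  have hkq : Fintype.card {x // ¬ p x} = n - k := by
    rw [Fintype.card_subtype_compl, hkp, Fintype.card_fin]
  obtain ⟨m0, hc⟩ := hev ⟨0, hn⟩
  set c := f^[m0] ⟨0, hn⟩
  let g : {x // p x} → {x // p x} := fun x => ⟨f x, hmaps _ x.2⟩
  have hg : ∀ m x, ((g^[m] x : {x // p x}) : Fin n) = f^[m] x := by
    intro m
    induction m with
    | zero => intro x; rfl
    | succ m ih => intro x; rw [Function.iterate_succ_apply, Function.iterate_succ_apply, ih]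
  rw [Matrix.twoBlockTriangular_det' _ p]
  · have h1 : (Matrix.toSquareBlockProp (lam • (1 : Matrix (Fin n) (Fin n) ℝ) - A) p)
        = lam • (1 : Matrix {x // p x} {x // p x} ℝ) - Matrix.toSquareBlockProp A p := by
      ext i j
      simp [Matrix.toSquareBlockProp, Matrix.one_apply, Subtype.ext_iff]
    have h2 : (Matrix.toSquareBlockProp (lam • (1 : Matrix (Fin n) (Fin n) ℝ) - A) p).det
        = lam ^ k - 1 := by
      rw [h1, hkp]
      apply det_cycle g _ _ ⟨c, hc⟩
      · obtain ⟨m, hm, hx⟩ := hc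
        exact ⟨m, hm, Subtype.ext ((hg _ _).trans hx)⟩
      · rintro ⟨y, hy⟩
        obtain ⟨a, b, hab⟩ := hmeet c y
        obtain ⟨m, hm, hx⟩ := hy
        have hle : b ≤ m * b := Nat.le_mul_of_pos_left b hm
        refine ⟨m * b - b + a, Subtype.ext ?_⟩
        rw [hg]
        change f^[m * b - b + a] c = y
        rw [Function.iterate_add_apply, hab, ← Function.iterate_add_apply,
          Nat.sub_add_cancel hle]
        exact hx.mul_const b
      · intro i j
        simp [Matrix.toSquareBlockProp, hA, g, Subtype.ext_iff]
    have h3 : (Matrix.toSquareBlockProp (lam • (1 : Matrix (Fin n) (Fin n) ℝ) - A)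
        (fun i => ¬ p i)).det = lam ^ (n - k) := by
      rw [← hkq]
      apply det_depth (fun i : {x // ¬ p x} => Nat.find (hev i))
      · rintro ⟨i, hi⟩
        have : i ≠ f i := fun h => hi ⟨1, one_pos, h.symm⟩
        simp [Matrix.toSquareBlockProp, hA, this]
      · rintro ⟨i, hi⟩ ⟨j, hj⟩ hij hle
        have hij' : i ≠ j := by simpa using hij
        have : j ≠ f i := by
          rintro rfl
          have hs := Nat.find_spec (hev i)
          change Nat.find (hev i) ≤ Nat.find (hev (f i)) at hle
          cases hm : Nat.find (hev i) with
          | zero => rw [hm] at hs; exact hi hs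
          | succ m =>
            rw [hm, Function.iterate_succ_apply] at hs
            have := Nat.find_min' (hev (f i)) hs
            omega
        simp [Matrix.toSquareBlockProp, hA, this, hij']
    rw [h2, h3, mul_comm]
  · intro i hi j hj
    have h1 : i ≠ j := by rintro rfl; exact hj hi
    have h2 : j ≠ f i := by rintro rfl; exact hj (hmaps i hi)
    simp [hA, h1, h2]
end

section
/- Spectrum of F^{0++} and F^{+0+} for a connected digraph-function: Let n ≥ 1, let f : Fin n → Fin n be a function whose digraph-function F = D_f is connected, and let k be the number of periodic points of f. Order the arcs of F so that arc i is (i, f i); then the transformations F^{0++} and F^{+0+} have adjacency matrices M₁ = fromBlocks 0 I_n A_f A_f and M₂ = fromBlocks A_f I_n A_f 0, respectively. Then for every λ ∈ ℝ: det(λ·I_{2n} − M₁) = det(λ·I_{2n} − M₂) = λ^{2(n−k)} · (λ^{2k} − (λ + 1)^k). -/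
open Matrix

lemma det_block_neg_one {n : ℕ} (P C D : Matrix (Fin n) (Fin n) ℝ) :
    (Matrix.fromBlocks P (-1) C D).det = (C + D * P).det := by
  have h : Matrix.fromBlocks P (-1) C D * Matrix.fromBlocks 1 0 P 1 * Matrix.fromBlocks 1 1 0 1
      * Matrix.fromBlocks 1 0 (-1) 1 * Matrix.fromBlocks 1 1 0 1
      = Matrix.fromBlocks 1 0 (-D) (C + D * P) := by
    simp [Matrix.fromBlocks_multiply]
    constructor <;> abel
  have h2 := congrArg Matrix.det h
  simpa [Matrix.det_mul, Matrix.det_fromBlocks_zero₁₂, Matrix.det_fromBlocks_zero₂₁] using h2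

lemma funGraph_meet {n : ℕ} (f : Fin n → Fin n) (hconn : (funGraph f).Connected) (x y : Fin n) :
    ∃ i j, f^[i] x = f^[j] y := by
  obtain ⟨w⟩ := hconn.preconnected x y
  induction w with
  | nil => exact ⟨0, 0, rfl⟩
  | @cons u v w h p ih =>
    obtain ⟨i, j, hij⟩ := ih
    rcases h.2 with h | h
    · exact ⟨i + 1, j, by rw [Function.iterate_succ_apply, h, hij]⟩
    · refine ⟨i, j + 1, ?_⟩
      rw [← h, ← Function.iterate_succ_apply, Function.iterate_succ_apply', hij,
        Function.iterate_succ_apply']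

lemma funGraph_reach {n : ℕ} (f : Fin n → Fin n) (hconn : (funGraph f).Connected) (x y : Fin n)
    (hy : y ∈ Function.periodicPts f) : ∃ i, f^[i] x = y := by
  obtain ⟨i, j, hij⟩ := funGraph_meet f hconn x y
  obtain ⟨m, hm, hp⟩ := hy
  refine ⟨(m * j - j) + i, ?_⟩
  rw [Function.iterate_add_apply, hij, ← Function.iterate_add_apply,
    Nat.sub_add_cancel (Nat.le_mul_of_pos_left j hm)]
  exact (hp.mul_const j)

lemma exists_periodic {n : ℕ} (f : Fin n → Fin n) (x : Fin n) :
    ∃ c, c ∈ Function.periodicPts f := by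
  obtain ⟨i, j, hne, hij⟩ := Finite.exists_ne_map_eq_of_infinite (fun i : ℕ => f^[i] x)
  wlog h : i < j generalizing i j
  · exact this j i hne.symm hij.symm (by omega)
  refine ⟨f^[i] x, j - i, by omega, ?_⟩
  change f^[j - i] (f^[i] x) = f^[i] x
  rw [← Function.iterate_add_apply, Nat.sub_add_cancel h.le]
  exact hij.symm

/-- A permutation choosing at each point `i` or `f i` follows `f` from any moved point. -/
lemma perm_iter {n : ℕ} (f : Fin n → Fin n) (σ : Equiv.Perm (Fin n))
    (hσ : ∀ i, σ i = i ∨ σ i = f i) (x : Fin n) (hx : σ x ≠ x) (j : ℕ) :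
    (σ ^ j) x = f^[j] x ∧ σ (f^[j] x) = f (f^[j] x) := by
  have key : ∀ j : ℕ, σ ((σ ^ j) x) = f ((σ ^ j) x) := by
    intro j
    refine (hσ _).resolve_left fun h => hx ?_
    have : (σ ^ j) (σ x) = (σ ^ j) x := by
      rw [← Equiv.Perm.mul_apply, ← pow_succ, pow_succ', Equiv.Perm.mul_apply, h]
    exact (σ ^ j).injective this
  have h1 : (σ ^ j) x = f^[j] x := by
    induction j with
    | zero => rfl
    | succ j ih => rw [pow_succ', Equiv.Perm.mul_apply, key, ih, Function.iterate_succ_apply']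
  exact ⟨h1, h1 ▸ key j⟩

lemma perm_moved_periodic {n : ℕ} (f : Fin n → Fin n) (σ : Equiv.Perm (Fin n))
    (hσ : ∀ i, σ i = i ∨ σ i = f i) (x : Fin n) (hx : σ x ≠ x) :
    x ∈ Function.periodicPts f := by
  refine ⟨orderOf σ, orderOf_pos σ, ?_⟩
  change f^[orderOf σ] x = x
  rw [← (perm_iter f σ hσ x hx _).1, pow_orderOf_eq_one, Equiv.Perm.one_apply]

open Classical in
lemma det_function_matrix {n : ℕ} (hn : 1 ≤ n) (f : Fin n → Fin n)
    (hconn : (funGraph f).Connected) (k : ℕ)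
    (hk : k = (Finset.univ.filter (fun x => x ∈ Function.periodicPts f)).card)
    (M : Matrix (Fin n) (Fin n) ℝ) (a b : ℝ)
    (hM : ∀ i j, M i j = (if i = j then a else 0) - (if j = f i then b else 0)) :
    M.det = a ^ (n - k) * (a ^ k - b ^ k) := by
  obtain ⟨c, hc⟩ := exists_periodic f ⟨0, hn⟩
  have hkn : k ≤ n := by
    rw [hk]; exact (Finset.card_le_univ _).trans (by simp)
  have hz : ∀ σ : Equiv.Perm (Fin n), (∏ i, M i (σ i)) ≠ 0 → ∀ i, σ i = i ∨ σ i = f i := by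
    intro σ h i
    by_contra! hcon
    apply h
    apply Finset.prod_eq_zero (Finset.mem_univ i)
    rw [hM, if_neg hcon.1.symm, if_neg hcon.2, sub_zero]
  rw [← Matrix.det_transpose, Matrix.det_apply']
  simp only [Matrix.transpose_apply]
  by_cases hfix : f c = c
  · have hP : ∀ y, y ∈ Function.periodicPts f ↔ y = c := by
      intro y
      constructor
      · intro hy
        obtain ⟨i, hi⟩ := funGraph_reach f hconn c y hy
        rw [← hi, Function.iterate_fixed hfix]
      · rintro rfl; exact hc
    have hk1 : k = 1 := by
      rw [hk]; simp [hP, Finset.filter_eq']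
    rw [Finset.sum_eq_single 1]
    · have : ∀ i, M i ((1 : Equiv.Perm (Fin n)) i) = if i = c then a - b else a := by
        intro i
        rw [hM]
        rw [Equiv.Perm.one_apply, if_pos rfl]
        by_cases hi : i = c
        · rw [if_pos hi, if_pos (by rw [hi, hfix])]
        · rw [if_neg hi, if_neg (fun h => hi ((hP i).1 ⟨1, one_pos, h.symm⟩)), sub_zero]
      simp only [this]
      rw [Finset.prod_ite]
      simp [Finset.filter_eq', Finset.filter_ne', hk1, Finset.card_erase_of_mem, mul_comm]
    · intro σ _ hσ
      by_contra hne
      have h := hz σ (right_ne_zero_of_mul hne)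
      apply hσ
      ext1 i
      by_contra hi
      have := (hP i).1 (perm_moved_periodic f σ h i hi)
      subst this
      rcases h i with h | h
      · exact hi h
      · exact hi (h.trans hfix)
    · simp
  · have hnf : ∀ y, f y ≠ y := by
      intro y hy
      obtain ⟨i, hi⟩ := funGraph_reach f hconn y c hc
      rw [Function.iterate_fixed hy] at hi
      exact hfix (hi ▸ hy)
    obtain ⟨g, hg1, hg2⟩ : ∃ g : Equiv.Perm (Fin n),
        (∀ y ∈ Function.periodicPts f, g y = f y) ∧ (∀ y ∉ Function.periodicPts f, g y = y) := by
      refine ⟨Equiv.Perm.ofSubtype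
        (Set.BijOn.equiv f (Function.bijOn_periodicPts f) : Equiv.Perm (Function.periodicPts f)),
        fun y hy => ?_, fun y hy => ?_⟩
      · rw [Equiv.Perm.ofSubtype_apply_of_mem _ hy]; rfl
      · rw [Equiv.Perm.ofSubtype_apply_of_not_mem _ hy]
    have hgσ : ∀ i, g i = i ∨ g i = f i := by
      intro i
      by_cases h : i ∈ Function.periodicPts f
      · exact .inr (hg1 i h)
      · exact .inl (hg2 i h)
    have hgc : g c ≠ c := by rw [hg1 c hc]; exact hfix
    have hg_ne : (1 : Equiv.Perm (Fin n)) ≠ g := by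
      rintro rfl; exact hgc rfl
    have hsupp : g.support = Finset.univ.filter (fun x => x ∈ Function.periodicPts f) := by
      ext y
      simp only [Equiv.Perm.mem_support, Finset.mem_filter, Finset.mem_univ, true_and]
      refine ⟨fun h => by_contra fun hy => h (hg2 y hy), fun h => ?_⟩
      rw [hg1 y h]; exact hnf y
    have hcyc : g.IsCycle := by
      refine ⟨c, hgc, fun y hy => ?_⟩
      obtain ⟨i, hi⟩ := funGraph_reach f hconn c y (perm_moved_periodic f g hgσ y hy)
      exact ⟨i, by rw [zpow_natCast, (perm_iter f g hgσ c hgc i).1, hi]⟩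
    rw [← Finset.sum_subset (Finset.subset_univ {1, g}), Finset.sum_pair hg_ne]
    · have e1 : ∏ i, M i ((1 : Equiv.Perm (Fin n)) i) = a ^ n := by
        have : ∀ i, M i ((1 : Equiv.Perm (Fin n)) i) = a := by
          intro i
          simp [hM, (hnf i).symm]
        rw [Finset.prod_congr rfl (fun i _ => this i)]
        simp
      have e2 : ∏ i, M i (g i) = (-b) ^ k * a ^ (n - k) := by
        have : ∀ i, M i (g i) = if i ∈ Function.periodicPts f then -b else a := by
          intro i
          rw [hM]
          by_cases hi : i ∈ Function.periodicPts f
          · rw [if_pos hi, hg1 i hi, if_neg (hnf i).symm, if_pos rfl, zero_sub]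
          · rw [if_neg hi, hg2 i hi, if_pos rfl, if_neg (hnf i).symm, sub_zero]
        simp only [this]
        rw [Finset.prod_ite, Finset.prod_const, Finset.prod_const, ← hk, Finset.filter_not,
          Finset.card_sdiff_of_subset (Finset.filter_subset _ _), ← hk]
        simp
      rw [e1, e2, hcyc.sign, hsupp, ← hk]
      obtain ⟨d, rfl⟩ := Nat.exists_eq_add_of_le hkn
      have e3 : ((-1 : ℝ) ^ k) * (-1) ^ k = 1 := by rw [← mul_pow]; simp
      rw [neg_pow b, Nat.add_sub_cancel_left]
      push_cast
      simp only [Equiv.Perm.sign_one, Units.val_one, Int.cast_one]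
      linear_combination (-(b ^ k * a ^ d)) * e3
    · intro σ _ hσ
      by_contra hne
      have h := hz σ (right_ne_zero_of_mul hne)
      apply hσ
      simp only [Finset.mem_insert, Finset.mem_singleton]
      by_cases h1 : σ = 1
      · exact .inl h1
      right
      obtain ⟨x, hx⟩ : ∃ x, σ x ≠ x := by
        by_contra! hall
        exact h1 (Equiv.ext hall)
      ext1 y
      by_cases hy : y ∈ Function.periodicPts f
      · obtain ⟨i, hi⟩ := funGraph_reach f hconn x y hy
        rw [hg1 y hy, ← hi]
        exact (perm_iter f σ h x hx i).2
      · rw [hg2 y hy]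
        by_contra hyy
        exact hy (perm_moved_periodic f σ h y hyy)

/-- Spectrum of `F^{0++}` and `F^{+0+}` for a connected digraph-function `F = D_f`. -/
theorem spectrum_digraph_function_transformations (n : ℕ) (hn : 1 ≤ n)
    (f : Fin n → Fin n) (hconn : (funGraph f).Connected)
    (k : ℕ) (hk : k = Nat.card {x : Fin n // ∃ m, 1 ≤ m ∧ f^[m] x = x})
    (A : Matrix (Fin n) (Fin n) ℝ)
    (hA : ∀ i j, A i j = if j = f i then 1 else 0)
    (lam : ℝ) :
    (lam • (1 : Matrix (Fin n ⊕ Fin n) (Fin n ⊕ Fin n) ℝ)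
        - Matrix.fromBlocks 0 1 A A).det
      = (lam • (1 : Matrix (Fin n ⊕ Fin n) (Fin n ⊕ Fin n) ℝ)
        - Matrix.fromBlocks A 1 A 0).det
    ∧ (lam • (1 : Matrix (Fin n ⊕ Fin n) (Fin n ⊕ Fin n) ℝ)
        - Matrix.fromBlocks 0 1 A A).det
      = lam ^ (2 * (n - k)) * (lam ^ (2 * k) - (lam + 1) ^ k) := by
  classical
  have hk' : k = (Finset.univ.filter (fun x => x ∈ Function.periodicPts f)).card := by
    rw [hk, Nat.card_eq_fintype_card, Fintype.card_subtype]
    rfl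
  have b1 : lam • (1 : Matrix (Fin n ⊕ Fin n) (Fin n ⊕ Fin n) ℝ) - Matrix.fromBlocks 0 1 A A
      = Matrix.fromBlocks (lam • 1) (-1) (-A) (lam • 1 - A) := by
    rw [← Matrix.fromBlocks_one, Matrix.fromBlocks_smul, sub_eq_add_neg, Matrix.fromBlocks_neg,
      Matrix.fromBlocks_add]
    simp [sub_eq_add_neg]
  have b2 : lam • (1 : Matrix (Fin n ⊕ Fin n) (Fin n ⊕ Fin n) ℝ) - Matrix.fromBlocks A 1 A 0
      = Matrix.fromBlocks (lam • 1 - A) (-1) (-A) (lam • 1) := by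
    rw [← Matrix.fromBlocks_one, Matrix.fromBlocks_smul, sub_eq_add_neg, Matrix.fromBlocks_neg,
      Matrix.fromBlocks_add]
    simp [sub_eq_add_neg]
  rw [b1, b2, det_block_neg_one, det_block_neg_one]
  refine ⟨by simp, ?_⟩
  rw [det_function_matrix hn f hconn k hk' _ (lam ^ 2) (lam + 1), pow_mul, pow_mul]
  intro i j
  simp only [Matrix.mul_smul, mul_one, Matrix.add_apply, Matrix.neg_apply, Matrix.smul_apply,
    Matrix.sub_apply, Matrix.one_apply, hA, smul_eq_mul]
  split_ifs <;> ring
end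

section
/- A connected digraph is isomorphic to its line digraph iff it is a digraph-function or the inverse of a digraph-function: Let V be a nonempty finite type and E : V → V → Prop a digraph (at most one arc per ordered pair; loops allowed), and suppose D = (V, E) is connected, i.e. the simple graph on V in which distinct x, y are adjacent iff E x y ∨ E y x is connected. Let the line digraph D^l have vertex type {p : V × V // E p.1 p.2} with an arc from p to q iff p.1.2 = q.1.1 (the head of arc p equals the tail of arc q). Then the following are equivalent: (i) there exists an equivalence φ : V ≃ {p : V × V // E p.1 p.2} such that for all v, w : V, E v w ↔ (φ v).1.2 = (φ w).1.1 (i.e. D is isomorphic to D^l); (ii) every vertex of D has out-degree 1, or every vertex of D has in-degree 1 (where the out-degree of v is the cardinality of {w : E v w} and the in-degree of v is the cardinality of {w : E w v}). -/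
/-- The underlying simple graph of a digraph given by a relation `E`. -/
def underlyingGraph {V : Type*} (E : V → V → Prop) : SimpleGraph V where
  Adj x y := x ≠ y ∧ (E x y ∨ E y x)
  symm := ⟨fun _ _ h => ⟨h.1.symm, h.2.symm⟩⟩
  loopless := ⟨fun _ h => h.1 rfl⟩

namespace LineDig

open Relation Finset

/-- Data of an isomorphism to the line digraph: tails `a`, heads `b`. -/
structure Iso {V : Type*} (E : V → V → Prop) (a b : V → V) : Prop where
  arc : ∀ e, E (a e) (b e)
  ex : ∀ u v, E u v → ∃ e, a e = u ∧ b e = v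
  inj : ∀ e f, a e = a f → b e = b f → e = f
  iff : ∀ v w, E v w ↔ b v = a w

/-- Circulations. -/
def Circ {V : Type*} [Fintype V] (a b : V → V) (c : V → ℚ) : Prop :=
  ∀ f : V → ℚ, ∑ e, c e * (f (b e) - f (a e)) = 0

theorem const_of {V : Type*} {E : V → V → Prop}
    (hconn : (underlyingGraph E).Connected) (f : V → ℚ)
    (h : ∀ u v, E u v → f u = f v) (x y : V) : f x = f y := by
  obtain ⟨p⟩ := hconn.preconnected x y
  induction p with
  | nil => rfl
  | cons hadj _ ih =>
    rw [← ih]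
    rcases hadj.2 with h1 | h1
    · exact h _ _ h1
    · exact (h _ _ h1).symm

theorem prop_of {V : Type*} [Fintype V] {E : V → V → Prop} {a b : V → V}
    (hconn : (underlyingGraph E).Connected) (hI : Iso E a b)
    (c k : V → ℚ) (hc : Circ a b c) (hk : Circ a b k) (hc0 : c ≠ 0) :
    ∃ t : ℚ, k = t • c := by
  classical
  let M : Matrix V V ℚ := fun e v => (if b e = v then 1 else 0) - (if a e = v then 1 else 0)
  have hM : ∀ f e, (M.mulVec f) e = f (b e) - f (a e) := by
    intro f e
    simp [M, Matrix.mulVec, dotProduct, sub_mul, Finset.sum_sub_distrib]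
  have hker : Module.finrank ℚ (LinearMap.ker M.mulVecLin) ≤ 1 := by
    obtain ⟨x0⟩ := hconn.nonempty
    rw [finrank_le_one_iff]
    have h1 : (fun _ => 1 : V → ℚ) ∈ LinearMap.ker M.mulVecLin := by
      rw [LinearMap.mem_ker]; ext e; simp [hM]
    refine ⟨⟨_, h1⟩, ?_⟩
    rintro ⟨f, hf⟩
    refine ⟨f x0, ?_⟩
    ext v
    simp only [SetLike.mk_smul_mk, Pi.smul_apply, smul_eq_mul, mul_one]
    refine const_of hconn f ?_ x0 v
    intro u v huv
    obtain ⟨e, rfl, rfl⟩ := hI.ex u v huv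
    rw [LinearMap.mem_ker] at hf
    have := congrFun hf e
    rw [Matrix.mulVecLin_apply, hM] at this
    simp at this
    linarith
  have h1 := LinearMap.finrank_range_add_finrank_ker M.mulVecLin
  have h2 := LinearMap.finrank_range_add_finrank_ker M.transpose.mulVecLin
  have h3 := Matrix.rank_transpose M
  unfold Matrix.rank at h3
  have hker' : Module.finrank ℚ (LinearMap.ker M.transpose.mulVecLin) ≤ 1 := by omega
  have hmem : ∀ c, Circ a b c → c ∈ LinearMap.ker M.transpose.mulVecLin := by
    intro c hc
    rw [LinearMap.mem_ker]
    ext v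
    have := hc (fun u => if u = v then 1 else 0)
    simp only [Matrix.mulVecLin_apply, Matrix.mulVec, dotProduct, Matrix.transpose_apply, M,
      Pi.zero_apply]
    exact (Finset.sum_congr rfl fun e _ => mul_comm _ _).trans this
  rw [finrank_le_one_iff] at hker'
  obtain ⟨g, hg⟩ := hker'
  obtain ⟨s, hs⟩ := hg ⟨c, hmem c hc⟩
  obtain ⟨r, hr⟩ := hg ⟨k, hmem k hk⟩
  have hs' : s • (g : V → ℚ) = c := congrArg Subtype.val hs
  have hr' : r • (g : V → ℚ) = k := congrArg Subtype.val hr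
  have hs0 : s ≠ 0 := by
    rintro rfl
    exact hc0 (by rw [← hs', zero_smul])
  refine ⟨r / s, ?_⟩
  rw [← hs', ← hr', smul_smul, div_mul_cancel₀ _ hs0]

theorem walk_circ {V : Type*} [Fintype V] {E : V → V → Prop} {a b : V → V}
    (hI : Iso E a b) {x y : V} (h : TransGen E x y) :
    ∃ c : V → ℚ, (∀ e, 0 ≤ c e) ∧ (∃ e, 0 < c e) ∧
      (∀ e, c e ≠ 0 → ReflTransGen E x (a e) ∧ ReflTransGen E (b e) y) ∧
      ∀ f : V → ℚ, ∑ e, c e * (f (b e) - f (a e)) = f y - f x := by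
  classical
  induction h with
  | single h =>
    obtain ⟨e, rfl, rfl⟩ := hI.ex _ _ h
    refine ⟨fun i => if i = e then 1 else 0, ?_, ⟨e, by simp⟩, ?_, ?_⟩
    · intro i; dsimp only; split_ifs <;> norm_num
    · intro i hi
      have : i = e := by by_contra hne; simp [hne] at hi
      subst this
      exact ⟨.refl, .refl⟩
    · intro f; simp
  | tail hxy h ih =>
    obtain ⟨c, h0, ⟨e0, he0⟩, hs, hf⟩ := ih
    obtain ⟨e, rfl, rfl⟩ := hI.ex _ _ h
    have hnn : ∀ i, (0:ℚ) ≤ if i = e then 1 else 0 := by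
      intro i; split_ifs <;> norm_num
    refine ⟨fun i => c i + if i = e then 1 else 0, ?_, ⟨e0, ?_⟩, ?_, ?_⟩
    · intro i; exact add_nonneg (h0 i) (hnn i)
    · exact add_pos_of_pos_of_nonneg he0 (hnn _)
    · intro i hi
      by_cases hie : i = e
      · subst hie
        exact ⟨hxy.to_reflTransGen, .refl⟩
      · have : c i ≠ 0 := by simpa [hie] using hi
        exact ⟨(hs i this).1, (hs i this).2.tail h⟩
    · intro f
      simp only [add_mul, Finset.sum_add_distrib, hf]
      simp

theorem exists_closed {V : Type*} [Finite V] {E : V → V → Prop} (x : V)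
    (h : ∀ w, ReflTransGen E x w → ∃ w', E w w') :
    ∃ z, ReflTransGen E x z ∧ TransGen E z z := by
  let S : Set V := {w | ReflTransGen E x w}
  obtain ⟨z, hz, hmin⟩ := Set.exists_min_image S (fun w => Set.ncard {u | TransGen E w u})
    (Set.toFinite _) ⟨x, .refl⟩
  obtain ⟨z', hz'⟩ := h z hz
  have hxz' : ReflTransGen E x z' := ReflTransGen.tail hz hz'
  refine ⟨z', hxz', ?_⟩
  have hsub : {u | TransGen E z' u} ⊆ {u | TransGen E z u} := fun u hu => TransGen.head hz' hu
  have := Set.eq_of_subset_of_ncard_le hsub (hmin z' hxz') (Set.toFinite _)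
  have h2 : z' ∈ {u | TransGen E z u} := TransGen.single hz'
  rw [← this] at h2
  exact h2

theorem exists_closed0 {V : Type*} [Finite V] [Nonempty V] {E : V → V → Prop} {a b : V → V}
    (hI : Iso E a b) : ∃ z, TransGen E z z := by
  by_contra! hno
  have : Std.Irrefl (TransGen E) := ⟨hno⟩
  have wf : WellFounded (TransGen E) := Finite.wellFounded_of_trans_of_irrefl _
  have wfE : WellFounded E := Subrelation.wf (fun h => TransGen.single h) wf
  have iwf : IsWellFounded V E := ⟨wfE⟩
  have key : ∀ v, IsWellFounded.rank E v ≤ IsWellFounded.rank E (a v) := by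
    intro v
    induction v using wfE.induction with
    | _ v ih =>
      rw [IsWellFounded.rank_eq]
      refine Ordinal.iSup_le ?_
      rintro ⟨u, hu⟩
      have h1 := ih u hu
      have h2 := IsWellFounded.rank_lt_of_rel (hI.arc u)
      rw [(hI.iff u v).1 hu] at h2
      exact Order.succ_le_of_lt (h1.trans_lt h2)
  obtain ⟨v, hv⟩ := Finite.exists_max (fun v => IsWellFounded.rank E v)
  exact absurd (hv (b v)) (not_le.2 ((key v).trans_lt (IsWellFounded.rank_lt_of_rel (hI.arc v))))

theorem noK22 {V : Type*} [Fintype V] [Nonempty V] {E : V → V → Prop} {a b : V → V}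
    (hconn : (underlyingGraph E).Connected) (hI : Iso E a b)
    (e₁ e₂ f₁ f₂ : V) (he : e₁ ≠ e₂) (hf : f₁ ≠ f₂) (h : b e₁ = b e₂) (h' : a f₁ = a f₂)
    (hh : b e₁ = a f₁) : False := by
  classical
  obtain ⟨z, hz⟩ := exists_closed0 hI
  obtain ⟨c, h0, ⟨e0, he0⟩, -, hc⟩ := walk_circ hI hz
  obtain ⟨p, hpa, hpb⟩ := hI.ex e₁ f₁ ((hI.iff _ _).2 hh)
  obtain ⟨q, hqa, hqb⟩ := hI.ex e₁ f₂ ((hI.iff _ _).2 (hh.trans h'))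
  obtain ⟨r, hra, hrb⟩ := hI.ex e₂ f₁ ((hI.iff _ _).2 (h.symm.trans hh))
  obtain ⟨s, hsa, hsb⟩ := hI.ex e₂ f₂ ((hI.iff _ _).2 (h.symm.trans (hh.trans h')))
  have hpq : p ≠ q := by rintro rfl; exact hf (hpb.symm.trans hqb)
  have hpr : p ≠ r := by rintro rfl; exact he (hpa.symm.trans hra)
  have hqs : q ≠ s := by rintro rfl; exact he (hqa.symm.trans hsa)
  let i : V → V → ℚ := fun u e => if e = u then 1 else 0
  obtain ⟨t, ht⟩ := prop_of hconn hI c (fun e => i p e - i q e - i r e + i s e)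
    (fun f => by rw [hc, sub_self])
    (fun f => by
      simp only [i, add_mul, sub_mul, Finset.sum_add_distrib, Finset.sum_sub_distrib, ite_mul,
        one_mul, zero_mul, Finset.sum_ite_eq', Finset.mem_univ, Finset.sum_ite_eq, if_true]
      rw [hpa, hpb, hqa, hqb, hra, hrb, hsa, hsb]; ring)
    (by rintro rfl; simp at he0)
  have h1 : 0 < t * c p := by
    have := congrFun ht p
    simp only [i, hpq, hpr, Pi.smul_apply, smul_eq_mul] at this
    rw [← this]
    by_cases hps : p = s <;> simp [hps] <;> norm_num
  have h2 : t * c q < 0 := by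
    have := congrFun ht q
    simp only [i, hpq.symm, hqs, Pi.smul_apply, smul_eq_mul] at this
    rw [← this]
    by_cases hqr : q = r <;> simp [hqr] <;> norm_num
  have := h0 p
  have := h0 q
  rcases le_total 0 t with h3 | h3 <;> nlinarith

/-- Walks of given length. -/
def W {V : Type*} (E : V → V → Prop) : ℕ → V → V → Prop
  | 0, u, v => u = v
  | n + 1, u, v => ∃ w, W E n u w ∧ E w v

theorem W_of {V : Type*} {E : V → V → Prop} {u v : V} (h : ReflTransGen E u v) :
    ∃ n, W E n u v := by
  induction h with
  | refl => exact ⟨0, rfl⟩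
  | tail _ h ih => obtain ⟨n, hn⟩ := ih; exact ⟨n + 1, _, hn, h⟩

theorem W_lift {V : Type*} {E : V → V → Prop} {a b : V → V} (hI : Iso E a b) (n : ℕ) :
    ∀ u v, W E (n + 1) u v → ∃ e f, a e = u ∧ b f = v ∧ W E n e f := by
  induction n with
  | zero =>
    rintro u v ⟨w, rfl, h⟩
    obtain ⟨e, h1, h2⟩ := hI.ex _ _ h
    exact ⟨e, e, h1, h2, rfl⟩
  | succ n ih =>
    rintro u v ⟨w, hw, h⟩
    obtain ⟨e, f, h1, h2, h3⟩ := ih u w hw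
    obtain ⟨g, h4, h5⟩ := hI.ex _ _ h
    exact ⟨e, g, h1, h5, f, h3, (hI.iff _ _).2 (h2.trans h4.symm)⟩

section
variable {V : Type*} [Fintype V]
open Classical in
/-- number of preimages -/
noncomputable def deg (a : V → V) (v : V) : ℕ := #{e | a e = v}

theorem deg_sum (a : V → V) : ∑ v, deg a v = Fintype.card V := by
  classical
  unfold deg
  rw [← Finset.card_univ, Finset.card_eq_sum_card_fiberwise (f := a) (t := univ) (by simp)]

theorem card_out {E : V → V → Prop} {a b : V → V} (hI : Iso E a b) (v : V) :
    Nat.card {w // E v w} = deg a v := by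
  classical
  have : deg a v = Nat.card {e // a e = v} := by
    rw [Nat.card_eq_fintype_card, Fintype.card_subtype]; unfold deg; congr
  rw [this]
  symm
  refine Nat.card_congr (Equiv.ofBijective
    (fun e : {e // a e = v} => (⟨b e.1, by have := hI.arc e.1; rwa [e.2] at this⟩ : {w // E v w})) ⟨?_, ?_⟩)
  · rintro ⟨e, he⟩ ⟨f, hf⟩ h
    exact Subtype.ext (hI.inj e f (he.trans hf.symm) (congrArg Subtype.val h))
  · rintro ⟨w, hw⟩
    obtain ⟨e, h1, h2⟩ := hI.ex _ _ hw
    exact ⟨⟨e, h1⟩, Subtype.ext h2⟩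

theorem card_out' {E : V → V → Prop} {a b : V → V} (hI : Iso E a b) (v : V) :
    Nat.card {w // E v w} = deg a (b v) := by
  classical
  have : deg a (b v) = Nat.card {e // a e = b v} := by
    rw [Nat.card_eq_fintype_card, Fintype.card_subtype]; unfold deg; congr
  rw [this]
  exact Nat.card_congr (Equiv.subtypeEquivRight fun w => by rw [hI.iff, eq_comm])

theorem Iso.flip {E : V → V → Prop} {a b : V → V} (hI : Iso E a b) :
    Iso (fun x y => E y x) b a where
  arc := hI.arc
  ex u v h := by obtain ⟨e, h1, h2⟩ := hI.ex v u h; exact ⟨e, h2, h1⟩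
  inj e f h1 h2 := hI.inj e f h2 h1
  iff v w := by rw [hI.iff, eq_comm]

theorem deg_one [Nonempty V] {E : V → V → Prop} {a b : V → V}
    (hconn : (underlyingGraph E).Connected) (hI : Iso E a b) (v : V) :
    deg b v = 1 ∨ deg a v = 1 := by
  classical
  have hprod : ∑ v, deg b v * deg a v = Fintype.card V := by
    have h1 : ∀ v, deg b v * deg a v = ∑ e with b e = v, deg a (b e) := by
      intro v
      rw [Finset.sum_congr rfl (g := fun _ => deg a v) (fun e he => by
        rw [(Finset.mem_filter.1 he).2])]
      simp only [Finset.sum_const, smul_eq_mul]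
      congr 1
    simp only [h1]
    rw [Finset.sum_fiberwise univ b (fun e => deg a (b e))]
    rw [← deg_sum a]
    exact Finset.sum_congr rfl fun e _ => by rw [← card_out' hI, card_out hI]
  have hsum : ∑ v, ((deg b v : ℤ) - 1) * ((deg a v : ℤ) - 1) = 0 := by
    have e1 : ∀ v, ((deg b v : ℤ) - 1) * ((deg a v : ℤ) - 1)
        = ((deg b v * deg a v : ℕ) : ℤ) - (deg b v : ℤ) - (deg a v : ℤ) + 1 := by
      intro v; push_cast; ring
    simp only [e1, Finset.sum_add_distrib, Finset.sum_sub_distrib, ← Nat.cast_sum, hprod, deg_sum]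
    simp
  have hle : ∀ v ∈ (univ : Finset V), ((deg b v : ℤ) - 1) * ((deg a v : ℤ) - 1) ≤ 0 := by
    intro v _
    by_contra! hpos
    have hcase : (2 ≤ deg b v ∧ 2 ≤ deg a v) ∨ (deg b v = 0 ∧ deg a v = 0) := by
      rcases pos_and_pos_or_neg_and_neg_of_mul_pos hpos with h | h <;> omega
    rcases hcase with ⟨h1, h2⟩ | ⟨h1, h2⟩
    · obtain ⟨e₁, he₁, e₂, he₂, he⟩ := Finset.one_lt_card.1 h1
      obtain ⟨f₁, hf₁, f₂, hf₂, hf⟩ := Finset.one_lt_card.1 h2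
      simp only [Finset.mem_filter, Finset.mem_univ, true_and] at he₁ he₂ hf₁ hf₂
      exact noK22 hconn hI e₁ e₂ f₁ f₂ he hf (he₁.trans he₂.symm) (hf₁.trans hf₂.symm)
        (he₁.trans hf₁.symm)
    · have hb : ∀ e, b e ≠ v := by
        intro e he
        have := Finset.card_eq_zero.1 h1
        have h3 : e ∈ (∅ : Finset V) := by rw [← this]; simp [he]
        simp at h3
      have ha : ∀ e, a e ≠ v := by
        intro e he
        have := Finset.card_eq_zero.1 h2
        have h3 : e ∈ (∅ : Finset V) := by rw [← this]; simp [he]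
        simp at h3
      have := const_of (E := E) hconn (fun u => if u = v then 1 else 0) (by
        intro u w h
        obtain ⟨e, rfl, rfl⟩ := hI.ex _ _ h
        simp [ha, hb]) v (a v)
      simp [ha] at this
  have := (Finset.sum_eq_zero_iff_of_nonpos hle).1 hsum v (mem_univ v)
  rcases mul_eq_zero.1 this with h | h <;> omega

theorem deg_walk [Nonempty V] {E : V → V → Prop} {a b : V → V}
    (hconn : (underlyingGraph E).Connected) (hI : Iso E a b) (n : ℕ) :
    ∀ u v, W E n u v → deg b u = 1 ∨ deg a v = 1 := by
  induction n with
  | zero => rintro u v rfl; exact deg_one hconn hI u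
  | succ n ih =>
    intro u v h
    obtain ⟨e, f, rfl, rfl, h3⟩ := W_lift hI n u v h
    have := ih e f h3
    rwa [← card_out hI, card_out' hI, ← card_out hI.flip, card_out' hI.flip] at this

theorem exists_two (a : V → V) (h : ¬ ∀ v, deg a v = 1) : ∃ v, 2 ≤ deg a v := by
  by_contra! hlt
  apply h
  have h1 : ∑ v, deg a v = ∑ _v : V, 1 := by rw [deg_sum]; simp
  have := (Finset.sum_eq_sum_iff_of_le (fun v _ => by have := hlt v; omega)).1 h1
  exact fun v => this v (mem_univ v)

theorem forward [Nonempty V] {E : V → V → Prop} {a b : V → V}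
    (hconn : (underlyingGraph E).Connected) (hI : Iso E a b) :
    (∀ v, deg a v = 1) ∨ (∀ v, deg b v = 1) := by
  by_contra! hcon
  obtain ⟨ha, hb⟩ := hcon
  obtain ⟨y, hy⟩ := exists_two a (by push Not; exact ha)
  obtain ⟨x, hx⟩ := exists_two b (by push Not; exact hb)
  have key : ∀ u v, ReflTransGen E u v → deg b u = 1 ∨ deg a v = 1 := by
    intro u v h
    obtain ⟨n, hn⟩ := W_of h
    exact deg_walk hconn hI n u v hn
  obtain ⟨z, hxz, hz⟩ := exists_closed (E := E) x (by
    intro w hw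
    have h1 : deg a w = 1 := by rcases key x w hw with h | h <;> omega
    rw [← card_out hI] at h1
    obtain ⟨⟨w', hw'⟩⟩ := (Nat.card_eq_one_iff_unique.1 h1).2
    exact ⟨w', hw'⟩)
  obtain ⟨z', hyz, hz'⟩ := exists_closed (E := fun p q => E q p) y (by
    intro w hw
    have h1 : deg b w = 1 := by
      rcases key w y (reflTransGen_swap.1 hw) with h | h <;> omega
    rw [← card_out hI.flip] at h1
    obtain ⟨⟨w', hw'⟩⟩ := (Nat.card_eq_one_iff_unique.1 h1).2
    exact ⟨w', hw'⟩)
  have hyz := reflTransGen_swap.1 hyz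
  have hz' := transGen_swap.1 hz'
  obtain ⟨c, -, ⟨e0, he0⟩, hs, hc⟩ := walk_circ hI hz
  obtain ⟨k, -, ⟨e1, he1⟩, hs', hk⟩ := walk_circ hI hz'
  obtain ⟨t, ht⟩ := prop_of hconn hI c k (fun f => by rw [hc, sub_self])
    (fun f => by rw [hk, sub_self]) (by rintro rfl; simp at he0)
  have hce : c e1 ≠ 0 := by
    intro h
    rw [ht] at he1
    simp [h] at he1
  have := key x y ((hxz.trans (hs e1 hce).1).trans
    ((ReflTransGen.single (hI.arc e1)).trans ((hs' e1 he1.ne').2.trans hyz)))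
  omega
end

end LineDig

theorem iso_line_digraph_iff_digraph_function (V : Type*) [Fintype V] [Nonempty V]
    (E : V → V → Prop)
    (hconn : (underlyingGraph E).Connected) :
    (∃ φ : V ≃ {p : V × V // E p.1 p.2},
        ∀ v w : V, E v w ↔ (φ v).1.2 = (φ w).1.1)
      ↔ ((∀ v : V, Nat.card {w : V // E v w} = 1)
          ∨ (∀ v : V, Nat.card {w : V // E w v} = 1)) := by
  constructor
  · rintro ⟨φ, hφ⟩
    have hI : LineDig.Iso E (fun v => (φ v).1.1) (fun v => (φ v).1.2) :=
      { arc := fun e => (φ e).2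
        ex := fun u v h => ⟨φ.symm ⟨(u, v), h⟩, by simp, by simp⟩
        inj := fun e f h1 h2 => φ.injective (Subtype.ext (Prod.ext h1 h2))
        iff := hφ }
    rcases LineDig.forward hconn hI with h | h
    · exact Or.inl fun v => by rw [LineDig.card_out hI]; exact h v
    · exact Or.inr fun v => by rw [LineDig.card_out hI.flip]; exact h v
  · rintro (h | h)
    · have h' : ∀ v, ∃ w, ∀ u, E v u ↔ w = u := by
        intro v
        obtain ⟨hs, ⟨w, hw⟩⟩ := Nat.card_eq_one_iff_unique.1 (h v)
        refine ⟨w, fun u => ⟨fun hu => ?_, fun hu => hu ▸ hw⟩⟩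
        exact congrArg Subtype.val (hs.elim ⟨w, hw⟩ ⟨u, hu⟩)
      choose f hf using h'
      refine ⟨⟨fun v => ⟨(v, f v), (hf _ _).2 rfl⟩, fun p => p.1.1, fun v => rfl, ?_⟩, fun v w => hf v w⟩
      rintro ⟨⟨u, v⟩, huv⟩
      exact Subtype.ext (Prod.ext rfl ((hf u v).1 huv))
    · have h' : ∀ v, ∃ w, ∀ u, E u v ↔ u = w := by
        intro v
        obtain ⟨hs, ⟨w, hw⟩⟩ := Nat.card_eq_one_iff_unique.1 (h v)
        refine ⟨w, fun u => ⟨fun hu => ?_, fun hu => hu ▸ hw⟩⟩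
        exact congrArg Subtype.val (hs.elim ⟨u, hu⟩ ⟨w, hw⟩)
      choose f hf using h'
      refine ⟨⟨fun v => ⟨(f v, v), (hf _ _).2 rfl⟩, fun p => p.1.2, fun v => rfl, ?_⟩, fun v w => hf w v⟩
      rintro ⟨⟨u, v⟩, huv⟩
      exact Subtype.ext (Prod.ext ((hf v u).1 huv).symm rfl)
end
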